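/- Let ℓ ≥ 1, 0 ≤ m ≤ ℓ, and let μ = (μ_1,…,μ_{2(ℓ−m)}) be an (ℓ−m, m)-balanced partition. Then the 2-sign of μ satisfies δ_2(μ) = (−1)^{μ_{ℓ−m+1} + μ_{ℓ−m+2} + ⋯ + μ_{2(ℓ−m)}}. -/

import Mathlib

open scoped BigOperators

/-- A partition, represented canonically as the multiset of its (positive) parts. -/
structure Ptn where
  parts : Multiset ℕ
  pos : ∀ x ∈ parts, 0 < x

namespace Ptn

/-- Build a partition from an arbitrary multiset of naturals by discarding zero parts. -/
def of (s : Multiset ℕ) : Ptn :=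
  ⟨s.filter (fun x => 0 < x), fun _ hx => (Multiset.mem_filter.mp hx).2⟩

/-- The empty partition. -/
def empty : Ptn := ⟨0, by simp⟩

/-- The `i`-th largest part (`0`-indexed); `0` if `i` is at least the number of parts. -/
def part (l : Ptn) (i : ℕ) : ℕ :=
  ((l.parts.sort (· ≤ ·)).reverse).getD i 0

/-- The number of (positive) parts. -/
def length (l : Ptn) : ℕ := Multiset.card l.parts

/-- The size `|λ|`, i.e. the number being partitioned. -/
def size (l : Ptn) : ℕ := l.parts.sum

/-- A partition is strict if all its parts are distinct. -/
def Strict (l : Ptn) : Prop := l.parts.Nodup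

/-- The conjugate partition. -/
def conj (l : Ptn) : Ptn :=
  of ((Multiset.range (l.part 0)).map
    (fun j => Multiset.card (l.parts.filter (fun x => j < x))))

end Ptn

/-- The rectangular partition `□(n,m)` with `n` rows of length `m`. -/
def rect (n m : ℕ) : Ptn := Ptn.of (Multiset.replicate n m)

/-- The partition obtained by multiplying every part by `r`. -/
def scaleP (r : ℕ) (l : Ptn) : Ptn := Ptn.of (l.parts.map (fun a => r * a))

/-- Diagram containment: every part of `small` is at most the corresponding part of `big`. -/
def Contains (big small : Ptn) : Prop := ∀ i, small.part i ≤ big.part i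

/-- The beta-set (first-column hook lengths) `{λ_i + m - 1 - i : i < m}` of `l`,
computed with `m` beads (`m` at least the number of parts). -/
def betaSet (l : Ptn) (m : ℕ) : Finset ℕ :=
  (Finset.range m).image (fun i => l.part i + (m - 1 - i))

/-- The partition encoded by a finite set of bead positions: each bead contributes a part
equal to the number of empty positions (holes) below it. -/
def ptnOfBeads (B : Finset ℕ) : Ptn :=
  Ptn.of (B.val.map (fun p => p - (B.filter (fun q => q < p)).card))

/-- Levels of the beads on runner `k` of the `r`-abacus of `l`,
drawn with `r * l.length` beads (a multiple of `r`). -/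
def runnerLevels (r : ℕ) (l : Ptn) (k : ℕ) : Finset ℕ :=
  (Finset.range (l.part 0 + r * l.length + 1)).filter
    (fun s => r * s + k ∈ betaSet l (r * l.length))

/-- The `k`-th component `λ[k]` of the `r`-quotient of `l`. -/
def quotP (r : ℕ) (l : Ptn) (k : ℕ) : Ptn := ptnOfBeads (runnerLevels r l k)

/-- The `r`-core of `l`: push all beads of the `r`-abacus down as far as possible. -/
def coreP (r : ℕ) (l : Ptn) : Ptn :=
  ptnOfBeads ((Finset.range r).biUnion
    (fun k => (Finset.range (runnerLevels r l k).card).image (fun s => r * s + k)))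

/-- The key of the bead at position `p` for the `r`-numbering of the beads `B`:
a bead which is the `j`-th lowest bead on runner `k` gets key `r * j + k`. -/
def rKey (r : ℕ) (B : Finset ℕ) (p : ℕ) : ℕ :=
  r * (B.filter (fun q => q % r = p % r ∧ q < p)).card + p % r

/-- The number of inversions between the natural (increasing-position) numbering of the
beads `B` and the numbering by increasing `key`. -/
def inversions (key : ℕ → ℕ) (B : Finset ℕ) : ℕ :=
  ((B ×ˢ B).filter (fun pq => pq.1 < pq.2 ∧ key pq.2 < key pq.1)).card

/-- Exponent of the `r`-sign `δ_r`. -/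
def rSignExp (r : ℕ) (l : Ptn) : ℕ :=
  inversions (rKey r (betaSet l (r * l.length))) (betaSet l (r * l.length))

/-- The `r`-sign `δ_r(λ) ∈ {±1}`. -/
def rSign (r : ℕ) (l : Ptn) : ℤ := (-1) ^ rSignExp r l

/-- The key of the bead at position `p` for the `3`-bar numbering of the beads `B` of the
`3`-bar abacus: first the beads of runner `0` in increasing order, then the pairs of beads
on runners `2` and `1` paired off by increasing level (runner-`2` bead before
runner-`1` bead), then the remaining unpaired beads in increasing order. -/
def barKey (B : Finset ℕ) (p : ℕ) : ℕ :=
  let n0 := (B.filter (fun q => q % 3 = 0)).card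
  let t := min ((B.filter (fun q => q % 3 = 1)).card)
              ((B.filter (fun q => q % 3 = 2)).card)
  let rk := (B.filter (fun q => q % 3 = p % 3 ∧ q < p)).card
  if p % 3 = 0 then rk
  else if rk < t then (if p % 3 = 2 then n0 + 2 * rk else n0 + 2 * rk + 1)
  else n0 + 2 * t + (rk - t)

/-- Exponent of the `3`-bar sign `δ̄_3`.  The beads of the `3`-bar abacus of a strict
partition sit at the positions given by the parts. -/
def barSignExp (l : Ptn) : ℕ :=
  inversions (barKey l.parts.toFinset) l.parts.toFinset

/-- The `3`-bar sign `δ̄_3(λ) ∈ {±1}` of a strict partition. -/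
def barSign3 (l : Ptn) : ℤ := (-1) ^ barSignExp l

/-- The double `D(λ) = (λ_1,…,λ_l | λ_1 - 1,…,λ_l - 1)` (Frobenius notation)
of a strict partition `λ`, constructed row by row. -/
noncomputable def double (l : Ptn) : Ptn :=
  Ptn.of ((Multiset.range (l.length + l.part 0)).map (fun i =>
    (if i < l.length then l.part i + 1 else 0) +
      ((Finset.range (min i l.length)).filter (fun j => i + 1 ≤ j + l.part j)).card))

/-- The second component `λ^b[1] = D(λ)[1]` of the `3`-bar quotient of a strict
partition `λ`. -/
noncomputable def barQuot1 (l : Ptn) : Ptn := quotP 3 (double l) 1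

/-- The staircase-like strict partition `Λ_ℓ = (3ℓ-2, 3ℓ-5, …, 7, 4, 1)`. -/
def LamP (ℓ : ℕ) : Ptn := Ptn.of ((Multiset.range ℓ).map (fun i => 3 * i + 1))

/-- The staircase partition `Δ_ℓ = (ℓ, ℓ-1, …, 1)`. -/
def DelP (ℓ : ℕ) : Ptn := Ptn.of (Multiset.range (ℓ + 1))

/-- `F_1^m(Λ_ℓ)`: strict partitions obtained from `Λ_ℓ` by adding `m` cells, each
labelled `1`, where the cell in (0-indexed) column `j` is labelled `1` iff `j % 3 = 1`
(each row reads `0,1,0,0,1,0,…`). -/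
def F1Lam (ℓ m : ℕ) : Set Ptn :=
  {mu | mu.Strict ∧ Contains mu (LamP ℓ) ∧ mu.size = (LamP ℓ).size + m ∧
    ∀ i j, (LamP ℓ).part i ≤ j → j < mu.part i → j % 3 = 1}

/-- `F_1^m(Δ_ℓ)`: partitions obtained from `Δ_ℓ` by adding `m` cells, each labelled `1`,
where the cell `(i,j)` is labelled `1` iff `i + j` is odd. -/
def F1Del (ℓ m : ℕ) : Set Ptn :=
  {mu | Contains mu (DelP ℓ) ∧ mu.size = (DelP ℓ).size + m ∧
    ∀ i j, (DelP ℓ).part i ≤ j → j < mu.part i → (i + j) % 2 = 1}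

/-- `(α, β)` is complementary relative to the rectangle `□(n,m)`:
`α ⊆ □(n,m)` and `β_i = m - α_{n+1-i}` for `1 ≤ i ≤ n` (0-indexed below). -/
def Complementary (n m : ℕ) (a b : Ptn) : Prop :=
  a.length ≤ n ∧ a.part 0 ≤ m ∧ b.length ≤ n ∧
    ∀ i < n, b.part i = m - a.part (n - 1 - i)

/-- `W(n,m)`: the set of `(n,m)`-balanced partitions, i.e. partitions of `2nm` with at
most `2n` parts satisfying `μ_i + μ_{2n+1-i} = 2m` for `1 ≤ i ≤ n` (0-indexed below). -/
def W (n m : ℕ) : Set Ptn :=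
  {mu | mu.size = 2 * n * m ∧ mu.length ≤ 2 * n ∧
    ∀ i < n, mu.part i + mu.part (2 * n - 1 - i) = 2 * m}

/-! ### The ring of symmetric functions

We realise the ring of symmetric functions (with rational coefficients) as the
polynomial ring `ℚ[p_1, p_2, …]` in the power sums: the variable `X n` of
`MvPolynomial ℕ ℚ` stands for the power sum `p_{n+1}`. -/

abbrev SymF := MvPolynomial ℕ ℚ

open MvPolynomial

/-- `z_ρ = ∏ a^{m_a} m_a!` for a partition given as a multiset `ρ`. -/
def zval (s : Multiset ℕ) : ℚ :=
  s.toFinset.prod (fun a => (a : ℚ) ^ s.count a * (Nat.factorial (s.count a) : ℚ))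

/-- The power sum product `p_ρ` of a multiset `ρ`. -/
noncomputable def pMult (s : Multiset ℕ) : SymF :=
  (s.map (fun a => (X (a - 1) : SymF))).prod

/-- The complete homogeneous symmetric function `h_n = Σ_{ρ ⊢ n} z_ρ⁻¹ p_ρ`. -/
noncomputable def hSym (n : ℕ) : SymF :=
  ∑ ρ : Nat.Partition n, (zval ρ.parts)⁻¹ • pMult ρ.parts

/-- `h_k` for an integer index, vanishing for negative `k`. -/
noncomputable def hz (k : ℤ) : SymF := if k < 0 then 0 else hSym k.toNat

/-- The Schur function `S_λ`, via the Jacobi–Trudi formula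
`S_λ = det(h_{λ_i - i + j})`. -/
noncomputable def schur (l : Ptn) : SymF :=
  Matrix.det (Matrix.of (fun i j : Fin l.length =>
    hz ((l.part i.val : ℤ) + (j.val : ℤ) - (i.val : ℤ))))

/-- The plethysm `p_r ∘ f`: the algebra endomorphism sending each power sum `p_k`
to `p_{rk}`, i.e. substituting `x_i^r` for each variable `x_i`. -/
noncomputable def pleth (r : ℕ) (f : SymF) : SymF :=
  MvPolynomial.aeval (fun n => (X (r * (n + 1) - 1) : SymF)) f

/-- The `z`-weight of a power-sum monomial (exponent vector `d`). -/
def zfac (d : ℕ →₀ ℕ) : ℚ :=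
  d.prod (fun i e => ((i : ℚ) + 1) ^ e * (Nat.factorial e : ℚ))

/-- The Hall inner product, for which `⟨p_ρ, p_σ⟩ = δ_{ρσ} z_ρ` and the Schur
functions are orthonormal. -/
noncomputable def hall (f g : SymF) : ℚ :=
  f.support.sum (fun d => f.coeff d * g.coeff d * zfac d)

/-- The multi-Littlewood–Richardson coefficient `LR^λ_{μ^0,…,μ^{r-1}}`:
the multiplicity of `S_λ` in `S_{μ^0} ⋯ S_{μ^{r-1}}`. -/
noncomputable def LRmulti (lam : Ptn) (r : ℕ) (q : ℕ → Ptn) : ℚ :=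
  hall ((Finset.range r).prod (fun k => schur (q k))) (schur lam)

/-- The Littlewood–Richardson coefficient `LR^λ_{α,β}`:
the multiplicity of `S_λ` in `S_α · S_β`. -/
noncomputable def LR2 (lam a b : Ptn) : ℚ := hall (schur a * schur b) (schur lam)

/-- The irreducible symmetric group character `χ^μ(ρ)`, via the Frobenius formula
`χ^μ_ρ = ⟨S_μ, p_ρ⟩`. -/
noncomputable def chi (mu rho : Ptn) : ℚ := hall (schur mu) (pMult rho.parts)

/-- Symmetric functions in two alphabets `u`, `v`: `X (inl n)` is `p_{n+1}(u)` and
`X (inr n)` is `p_{n+1}(v)`. -/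
abbrev SymF2 := MvPolynomial (ℕ ⊕ ℕ) ℚ

/-- `f ↦ f(u)`. -/
noncomputable def toU : SymF →ₐ[ℚ] SymF2 :=
  aeval (fun n => (X (Sum.inl n) : SymF2))

/-- `f ↦ f(v)`. -/
noncomputable def toV : SymF →ₐ[ℚ] SymF2 :=
  aeval (fun n => (X (Sum.inr n) : SymF2))

/-- `f ↦ f(u - v)`, the difference of alphabets: `p_k ↦ p_k(u) - p_k(v)`. -/
noncomputable def toUV : SymF →ₐ[ℚ] SymF2 :=
  aeval (fun n => (X (Sum.inl n) : SymF2) - X (Sum.inr n))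

section Inversions

/-- The number of elements of `s` below `p`, as a function of `p ∈ s`, enumerates
`0, …, s.card - 1`. -/
lemma sum_card_filter_lt {M : Type*} [AddCommMonoid M] (s : Finset ℕ) (g : ℕ → M) :
    ∑ p ∈ s, g (s.filter (· < p)).card = ∑ i ∈ Finset.range s.card, g i := by
  have hlt : ∀ p ∈ s, ∀ q ∈ s, p < q → (s.filter (· < p)).card < (s.filter (· < q)).card := by
    intro p hp q hq hpq
    refine Finset.card_lt_card (Finset.ssubset_iff_of_subset ?_ |>.mpr ⟨p, ?_, ?_⟩)
    · intro x hx
      simp only [Finset.mem_filter] at hx ⊢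
      exact ⟨hx.1, hx.2.trans hpq⟩
    · simp [hp, hpq]
    · simp
  have hinj : Set.InjOn (fun p => (s.filter (· < p)).card) s := by
    intro p hp q hq h
    rcases lt_trichotomy p q with h' | h' | h'
    · exact absurd h (hlt p hp q hq h').ne
    · exact h'
    · exact absurd h (hlt q hq p hp h').ne'
  have himg : s.image (fun p => (s.filter (· < p)).card) = Finset.range s.card := by
    refine Finset.eq_of_subset_of_card_le ?_ ?_
    · intro x hx
      obtain ⟨p, hp, rfl⟩ := Finset.mem_image.mp hx
      refine Finset.mem_range.mpr (Finset.card_lt_card ?_)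
      exact Finset.filter_ssubset.mpr ⟨p, hp, lt_irrefl p⟩
    · rw [Finset.card_image_of_injOn hinj, Finset.card_range]
  rw [← himg, Finset.sum_image hinj]

lemma sum_range_ite_lt (N a : ℕ) (ha : a ≤ N) :
    (∑ i ∈ Finset.range N, if i < a then (1 : ZMod 2) else 0) = a := by
  rw [← Finset.sum_filter, Finset.sum_const, nsmul_one]
  congr 1
  have : (Finset.range N).filter (· < a) = Finset.range a := by ext; simp; omega
  rw [this, Finset.card_range]

/-- For a bead configuration with `N` even and `N` odd beads, the parity of the number of
inversions of the `2`-numbering is that of the number of odd beads below even beads, plus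
`0 + 1 + ⋯ + (N - 1)`. -/
lemma inversions_rKey_two (B : Finset ℕ) (N : ℕ) (hE : (B.filter (· % 2 = 0)).card = N)
    (hO : (B.filter (¬ · % 2 = 0)).card = N) :
    (inversions (rKey 2 B) B : ZMod 2) =
      (∑ a ∈ B.filter (· % 2 = 0), ∑ b ∈ B.filter (¬ · % 2 = 0), if b < a then 1 else 0) +
        ∑ i ∈ Finset.range N, (i : ZMod 2) := by
  set E := B.filter (· % 2 = 0) with hEdef
  set O := B.filter (¬ · % 2 = 0) with hOdef
  have keyE : ∀ a ∈ E, rKey 2 B a = 2 * (E.filter (· < a)).card := by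
    intro a ha
    have h0 : a % 2 = 0 := (Finset.mem_filter.mp ha).2
    rw [rKey, h0, hEdef, Finset.filter_filter, add_zero]
  have keyO : ∀ b ∈ O, rKey 2 B b = 2 * (O.filter (· < b)).card + 1 := by
    intro b hb
    have h1 : b % 2 = 1 := by have := (Finset.mem_filter.mp hb).2; omega
    rw [rKey, h1, hOdef, Finset.filter_filter]
    congr 3
    ext x
    simp only [Finset.mem_filter]
    constructor <;> rintro ⟨h, h', h''⟩ <;> exact ⟨h, by omega, h''⟩
  have mono : ∀ (s : Finset ℕ) (p q : ℕ), p < q →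
      (s.filter (· < p)).card ≤ (s.filter (· < q)).card := by
    intro s p q h
    refine Finset.card_le_card fun x hx => ?_
    simp only [Finset.mem_filter] at hx ⊢
    exact ⟨hx.1, hx.2.trans h⟩
  have hsum : (inversions (rKey 2 B) B : ZMod 2) =
      ∑ p ∈ B, ∑ q ∈ B, if p < q ∧ rKey 2 B q < rKey 2 B p then 1 else 0 := by
    rw [inversions, ← Finset.sum_product', ← Finset.sum_filter, Finset.sum_const, nsmul_one]
  have hsplit : ∀ g : ℕ → ZMod 2, ∑ p ∈ B, g p = ∑ p ∈ E, g p + ∑ p ∈ O, g p := fun g =>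
    (Finset.sum_filter_add_sum_filter_not B _ g).symm
  have hEE : (∑ p ∈ E, ∑ q ∈ E,
      if p < q ∧ rKey 2 B q < rKey 2 B p then (1 : ZMod 2) else 0) = 0 := by
    refine Finset.sum_eq_zero fun p hp => Finset.sum_eq_zero fun q hq => if_neg ?_
    rintro ⟨h, h'⟩
    rw [keyE p hp, keyE q hq] at h'
    have := mono E p q h
    omega
  have hOO : (∑ p ∈ O, ∑ q ∈ O,
      if p < q ∧ rKey 2 B q < rKey 2 B p then (1 : ZMod 2) else 0) = 0 := by
    refine Finset.sum_eq_zero fun p hp => Finset.sum_eq_zero fun q hq => if_neg ?_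
    rintro ⟨h, h'⟩
    rw [keyO p hp, keyO q hq] at h'
    have := mono O p q h
    omega
  have hrank : (∑ a ∈ E, ∑ b ∈ O,
      if (O.filter (· < b)).card < (E.filter (· < a)).card then (1 : ZMod 2) else 0) =
        ∑ i ∈ Finset.range N, (i : ZMod 2) := by
    rw [← hE, ← sum_card_filter_lt]
    refine Finset.sum_congr rfl fun a _ => ?_
    rw [sum_card_filter_lt O (fun i => if i < (E.filter (· < a)).card then (1 : ZMod 2) else 0)]
    refine sum_range_ite_lt _ _ ?_
    rw [hO, ← hE]
    exact Finset.card_filter_le _ _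
  rw [hsum, hsplit]
  simp_rw [hsplit]
  rw [Finset.sum_add_distrib, Finset.sum_add_distrib, hEE, hOO, zero_add, add_zero, ← hrank,
    Finset.sum_comm (s := O) (t := E), ← Finset.sum_add_distrib, ← Finset.sum_add_distrib]
  refine Finset.sum_congr rfl fun a ha => ?_
  rw [← Finset.sum_add_distrib, ← Finset.sum_add_distrib]
  refine Finset.sum_congr rfl fun b hb => ?_
  rw [keyE a ha, keyO b hb]
  have hne : a ≠ b := by
    rintro rfl
    exact (Finset.mem_filter.mp hb).2 (Finset.mem_filter.mp ha).2
  have h2 : (1 + 1 : ZMod 2) = 0 := by decide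
  split_ifs <;> first | omega | simp [h2]

end Inversions

section Reflection

variable {e : ℕ → Prop} [DecidablePred e]

lemma count_of_reflect {n : ℕ} (he : ∀ i < 2 * n, (e (2 * n - 1 - i) ↔ ¬ e i)) :
    Nat.count e (2 * n) = n := by
  have h1 : ((Finset.range (2 * n)).filter e).card =
      ((Finset.range (2 * n)).filter (fun i => ¬ e i)).card := by
    refine Finset.card_bij' (fun i _ => 2 * n - 1 - i) (fun i _ => 2 * n - 1 - i) ?_ ?_ ?_ ?_
    all_goals
      intro i hi
      obtain ⟨hi, hi'⟩ := Finset.mem_filter.mp hi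
      have hi := Finset.mem_range.mp hi
    · exact Finset.mem_filter.mpr ⟨Finset.mem_range.mpr (by omega), by
        rw [he i hi]; simpa using hi'⟩
    · exact Finset.mem_filter.mpr ⟨Finset.mem_range.mpr (by omega), (he i hi).mpr hi'⟩
    · omega
    · omega
  have h2 := Finset.card_filter_add_card_filter_not (s := Finset.range (2 * n)) e
  rw [Finset.card_range, ← h1] at h2
  have h3 : Nat.count e (2 * n) = ((Finset.range (2 * n)).filter e).card :=
    Nat.count_eq_card_filter_range e (2 * n)
  omega

/-- If `e` is complemented by the reflection of `{0, …, 2n - 1}`, the pairs `i < j` with `e i`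
and `¬ e j` are permuted by the reflection, so modulo `2` only the symmetric ones count. -/
lemma sum_pairs_of_reflect {n : ℕ} (he : ∀ i < 2 * n, (e (2 * n - 1 - i) ↔ ¬ e i)) :
    (∑ j ∈ Finset.range (2 * n), if e j then (0 : ZMod 2) else Nat.count e j) =
      ∑ i ∈ Finset.range n, if e i then 1 else 0 := by
  have hpairs : (∑ j ∈ Finset.range (2 * n), if e j then (0 : ZMod 2) else Nat.count e j) =
      ∑ x ∈ (Finset.range (2 * n) ×ˢ Finset.range (2 * n)).filter
        (fun x => x.2 < x.1 ∧ e x.2 ∧ ¬ e x.1), (1 : ZMod 2) := by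
    rw [Finset.sum_filter, Finset.sum_product]
    refine Finset.sum_congr rfl fun j hj => ?_
    split_ifs with h
    · simp [h]
    · rw [Nat.count_eq_card_filter_range, ← nsmul_one, ← Finset.sum_const, ← Finset.sum_filter]
      refine Finset.sum_congr ?_ fun _ _ => rfl
      have := Finset.mem_range.mp hj
      ext i
      simp only [Finset.mem_filter, Finset.mem_range, h, not_false_eq_true, and_true]
      constructor
      · rintro ⟨h1, h2⟩; exact ⟨by omega, h1, h2⟩
      · rintro ⟨_, h1, h2⟩; exact ⟨h1, h2⟩
  rw [hpairs, ← Finset.sum_filter_add_sum_filter_not _ (fun x : ℕ × ℕ => x.1 + x.2 = 2 * n - 1)]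
  have hoff : (∑ x ∈ ((Finset.range (2 * n) ×ˢ Finset.range (2 * n)).filter
        (fun x => x.2 < x.1 ∧ e x.2 ∧ ¬ e x.1)).filter
          (fun x : ℕ × ℕ => ¬ x.1 + x.2 = 2 * n - 1), (1 : ZMod 2)) = 0 := by
    refine Finset.sum_involution (fun x _ => (2 * n - 1 - x.2, 2 * n - 1 - x.1)) ?_ ?_ ?_ ?_
    · intros; decide
    · rintro ⟨j, i⟩ hx _ h
      simp only [Finset.mem_filter, Finset.mem_product, Finset.mem_range, Prod.mk.injEq] at hx h
      omega
    · rintro ⟨j, i⟩ hx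
      simp only [Finset.mem_filter, Finset.mem_product, Finset.mem_range] at hx ⊢
      obtain ⟨⟨⟨hj, hi⟩, hij, hei, hej⟩, hne⟩ := hx
      rw [he i hi, he j hj]
      exact ⟨⟨⟨by omega, by omega⟩, by omega, hej, by simpa using hei⟩, by omega⟩
    · rintro ⟨j, i⟩ hx
      simp only [Finset.mem_filter, Finset.mem_product, Finset.mem_range, Prod.mk.injEq] at hx ⊢
      omega
  rw [hoff, add_zero, ← Finset.sum_filter]
  refine Finset.sum_bij' (fun x _ => x.2) (fun i _ => (2 * n - 1 - i, i)) ?_ ?_ ?_ ?_ ?_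
  · rintro ⟨j, i⟩ hx
    simp only [Finset.mem_filter, Finset.mem_product, Finset.mem_range] at hx ⊢
    exact ⟨by omega, hx.1.2.2.1⟩
  · intro i hi
    simp only [Finset.mem_filter, Finset.mem_product, Finset.mem_range] at hi ⊢
    rw [he i (by omega)]
    exact ⟨⟨⟨by omega, by omega⟩, by omega, hi.2, by simpa using hi.2⟩, by omega⟩
  · rintro ⟨j, i⟩ hx
    simp only [Finset.mem_filter, Finset.mem_product, Finset.mem_range, Prod.mk.injEq] at hx ⊢
    exact ⟨by omega, trivial⟩
  · intros; rfl
  · intros; rfl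

lemma count_add_two_mul {n : ℕ} (he : ∀ i < 2 * n, (e (2 * n - 1 - i) ↔ ¬ e i))
    (htail : ∀ i ≥ 2 * n, (e i ↔ i % 2 = 1)) (k : ℕ) :
    Nat.count e (2 * (n + k)) = n + k := by
  induction k with
  | zero => exact count_of_reflect he
  | succ k ih =>
    have h0 : ¬ e (2 * (n + k)) := by rw [htail _ (by omega)]; omega
    have h1 : e (2 * (n + k) + 1) := by rw [htail _ (by omega)]; omega
    rw [show 2 * (n + (k + 1)) = 2 * (n + k) + 1 + 1 by ring, Nat.count_succ, Nat.count_succ, ih,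
      if_neg h0, if_pos h1]
    omega

lemma sum_pairs_add_two_mul {n : ℕ} (he : ∀ i < 2 * n, (e (2 * n - 1 - i) ↔ ¬ e i))
    (htail : ∀ i ≥ 2 * n, (e i ↔ i % 2 = 1)) (k : ℕ) :
    (∑ j ∈ Finset.range (2 * (n + k)), if e j then (0 : ZMod 2) else Nat.count e j) +
        ∑ i ∈ Finset.range (n + k), (i : ZMod 2) =
      ∑ i ∈ Finset.range n, ((if e i then 1 else 0) + (i : ZMod 2)) := by
  induction k with
  | zero => rw [Finset.sum_add_distrib, add_zero, sum_pairs_of_reflect he]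
  | succ k ih =>
    have h0 : ¬ e (2 * (n + k)) := by rw [htail _ (by omega)]; omega
    have h1 : e (2 * (n + k) + 1) := by rw [htail _ (by omega)]; omega
    rw [show 2 * (n + (k + 1)) = 2 * (n + k) + 1 + 1 by ring, ← add_assoc n k 1,
      Finset.sum_range_succ, Finset.sum_range_succ, Finset.sum_range_succ _ (n + k),
      if_neg h0, if_pos h1, count_add_two_mul he htail, ← ih]
    linear_combination CharTwo.add_self_eq_zero (R := ZMod 2) ((n + k : ℕ) : ZMod 2)

end Reflection

namespace Ptn

lemma part_eq_zero_of_length_le (l : Ptn) {i : ℕ} (h : l.length ≤ i) : l.part i = 0 := by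
  rw [part, List.getD_eq_default]
  simpa [length] using h

lemma part_antitone (l : Ptn) : Antitone l.part := by
  intro i j hij
  rcases le_or_gt l.length j with h | h
  · rw [part_eq_zero_of_length_le l h]
    exact Nat.zero_le _
  · have hlen : (l.parts.sort (· ≤ ·)).reverse.length = l.length := by simp [length]
    have hs : (l.parts.sort (· ≤ ·)).reverse.Pairwise (· ≥ ·) :=
      List.pairwise_reverse.mpr (Multiset.pairwise_sort l.parts (· ≤ ·))
    rw [part, part, List.getD_eq_getElem _ _ (by omega), List.getD_eq_getElem _ _ (by omega)]
    rcases hij.eq_or_lt with rfl | hlt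
    · exact le_rfl
    · exact List.pairwise_iff_getElem.mp hs i j (by omega) (by omega) hlt

lemma length_eq_zero_of_size_eq_zero (l : Ptn) (h : l.size = 0) : l.length = 0 := by
  rw [length, Multiset.card_eq_zero]
  refine Multiset.eq_zero_of_forall_notMem fun x hx => ?_
  have := Multiset.single_le_sum (fun _ _ => Nat.zero_le _) x hx
  have := l.pos x hx
  rw [size] at h
  omega

end Ptn

/-- The parity of the exponent of the `2`-sign in terms of the rows `i` of `l` with
`l.part i + i` odd, which are those whose bead is even. -/
lemma rSignExp_two (l : Ptn)
    (hcount : Nat.count (fun i => (l.part i + i) % 2 = 1) (2 * l.length) = l.length) :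
    (rSignExp 2 l : ZMod 2) =
      (∑ j ∈ Finset.range (2 * l.length), if (l.part j + j) % 2 = 1 then (0 : ZMod 2)
        else Nat.count (fun i => (l.part i + i) % 2 = 1) j) +
      ∑ i ∈ Finset.range l.length, (i : ZMod 2) := by
  set L := l.length
  set β : ℕ → ℕ := fun i => l.part i + (2 * L - 1 - i) with hβ
  have hlt : ∀ i < 2 * L, ∀ j < 2 * L, i < j → β j < β i := by
    intro i hi j hj hij
    have := l.part_antitone hij.le
    simp only [hβ]
    omega
  have hiff : ∀ i < 2 * L, ∀ j < 2 * L, (β j < β i ↔ i < j) := by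
    intro i hi j hj
    refine ⟨fun h => ?_, hlt i hi j hj⟩
    by_contra hn
    rcases (not_lt.mp hn).eq_or_lt with rfl | h'
    · exact lt_irrefl _ h
    · exact absurd (hlt j hj i hi h') (by omega)
  have hinj : Set.InjOn β (Finset.range (2 * L) : Finset ℕ) := by
    intro i hi j hj h
    have hi := Finset.mem_range.mp hi
    have hj := Finset.mem_range.mp hj
    rcases lt_trichotomy i j with h' | h' | h'
    · exact absurd h (hlt i hi j hj h').ne'
    · exact h'
    · exact absurd h (hlt j hj i hi h').ne
  have hpar : ∀ i < 2 * L, (β i % 2 = 0 ↔ (l.part i + i) % 2 = 1) := by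
    intro i hi
    simp only [hβ]
    omega
  have hB : betaSet l (2 * L) = (Finset.range (2 * L)).image β := rfl
  have hE : (betaSet l (2 * L)).filter (· % 2 = 0) =
      ((Finset.range (2 * L)).filter (fun i => (l.part i + i) % 2 = 1)).image β := by
    rw [hB, Finset.filter_image]
    congr 1
    exact Finset.filter_congr fun i hi => hpar i (Finset.mem_range.mp hi)
  have hO : (betaSet l (2 * L)).filter (¬ · % 2 = 0) =
      ((Finset.range (2 * L)).filter (fun i => ¬ (l.part i + i) % 2 = 1)).image β := by
    rw [hB, Finset.filter_image]
    congr 1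
    exact Finset.filter_congr fun i hi => not_congr (hpar i (Finset.mem_range.mp hi))
  have hinjE : ∀ p : ℕ → Prop, ∀ [DecidablePred p],
      Set.InjOn β ((Finset.range (2 * L)).filter p : Finset ℕ) := fun p _ =>
    hinj.mono (Finset.coe_subset.mpr (Finset.filter_subset _ _))
  rw [Nat.count_eq_card_filter_range] at hcount
  have htot := Finset.card_filter_add_card_filter_not (s := Finset.range (2 * L))
    (fun i => (l.part i + i) % 2 = 1)
  rw [hcount, Finset.card_range] at htot
  rw [rSignExp, inversions_rKey_two _ L (by rw [hE, Finset.card_image_of_injOn (hinjE _), hcount])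
    (by rw [hO, Finset.card_image_of_injOn (hinjE _)]; omega), hE, hO,
    Finset.sum_image (hinjE _)]
  simp_rw [Finset.sum_image (hinjE _)]
  congr 1
  rw [Finset.sum_comm, Finset.sum_filter]
  refine Finset.sum_congr rfl fun j hj => ?_
  have hj := Finset.mem_range.mp hj
  rw [ite_not]
  split_ifs with h
  · rfl
  · rw [Nat.count_eq_card_filter_range, ← nsmul_one, ← Finset.sum_const, ← Finset.sum_filter,
      Finset.filter_filter]
    refine Finset.sum_congr ?_ fun _ _ => rfl
    ext i
    simp only [Finset.mem_filter, Finset.mem_range]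
    constructor
    · rintro ⟨h1, h2, h3⟩
      exact ⟨(hiff i h1 j hj).mp h3, h2⟩
    · rintro ⟨h1, h2⟩
      exact ⟨by omega, h2, (hiff i (by omega) j hj).mpr h1⟩

lemma rSignExp_two_of_mem_W {n m : ℕ} {μ : Ptn} (hμ : μ ∈ W n m) (hn : n ≤ μ.length) :
    (rSignExp 2 μ : ZMod 2) = ∑ i ∈ Finset.Ico n (2 * n), (μ.part i : ZMod 2) := by
  obtain ⟨-, hlen, hbal⟩ := hμ
  have he : ∀ i < 2 * n, ((μ.part (2 * n - 1 - i) + (2 * n - 1 - i)) % 2 = 1 ↔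
      ¬ (μ.part i + i) % 2 = 1) := by
    intro i hi
    have : μ.part i + μ.part (2 * n - 1 - i) = 2 * m := by
      rcases lt_or_ge i n with h | h
      · exact hbal i h
      · have := hbal (2 * n - 1 - i) (by omega)
        rw [show 2 * n - 1 - (2 * n - 1 - i) = i by omega] at this
        omega
    omega
  have htail : ∀ i ≥ 2 * n, ((μ.part i + i) % 2 = 1 ↔ i % 2 = 1) := by
    intro i hi
    rw [μ.part_eq_zero_of_length_le (by omega), zero_add]
  obtain ⟨k, hk⟩ := Nat.exists_eq_add_of_le hn
  have hcount := count_add_two_mul (e := fun i => (μ.part i + i) % 2 = 1) he htail k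
  have hsum := sum_pairs_add_two_mul (e := fun i => (μ.part i + i) % 2 = 1) he htail k
  rw [← hk] at hcount hsum
  rw [rSignExp_two μ hcount, hsum]
  refine Finset.sum_bij' (fun i _ => 2 * n - 1 - i) (fun i _ => 2 * n - 1 - i) ?_ ?_ ?_ ?_ ?_
  all_goals
    intro i hi
    simp only [Finset.mem_range, Finset.mem_Ico] at hi ⊢
  · omega
  · omega
  · omega
  · omega
  · have hb := hbal i hi
    have : ((if (μ.part i + i) % 2 = 1 then 1 else 0 : ℕ) + i : ℕ) ≡
        μ.part (2 * n - 1 - i) [MOD 2] := by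
      unfold Nat.ModEq
      split_ifs <;> omega
    have := (ZMod.natCast_eq_natCast_iff _ _ _).mpr this
    push_cast at this
    exact this

/-- Lemma 6.6: for `μ ∈ W(ℓ-m,m)`,
`δ_2(μ) = (-1)^{μ_{ℓ-m+1} + ⋯ + μ_{2(ℓ-m)}}`. -/
theorem stmt8 (ℓ m : ℕ) (hℓ : 1 ≤ ℓ) (hm : m ≤ ℓ) (μ : Ptn) (hμ : μ ∈ W (ℓ - m) m) :
    rSign 2 μ = (-1) ^ (∑ i ∈ Finset.Ico (ℓ - m) (2 * (ℓ - m)), μ.part i) := by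
  set n := ℓ - m
  have hsign : (rSignExp 2 μ : ZMod 2) = ((∑ i ∈ Finset.Ico n (2 * n), μ.part i : ℕ) : ZMod 2) := by
    rcases Nat.eq_zero_or_pos (n * m) with h0 | hpos
    · have hlen : μ.length = 0 := μ.length_eq_zero_of_size_eq_zero (by rw [hμ.1, mul_assoc, h0, mul_zero])
      have hpart : ∀ i, μ.part i = 0 := fun i => μ.part_eq_zero_of_length_le (by omega)
      simp [rSignExp, inversions, betaSet, hlen, hpart]
    · have hn : 0 < n := Nat.pos_of_mul_pos_right hpos
      have hm' : 0 < m := Nat.pos_of_mul_pos_left hpos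
      push_cast
      refine rSignExp_two_of_mem_W hμ ?_
      by_contra hlt
      have hbal := hμ.2.2 (n - 1) (by omega)
      rw [μ.part_eq_zero_of_length_le (by omega), μ.part_eq_zero_of_length_le (by omega)] at hbal
      omega
  have hmod := (ZMod.natCast_eq_natCast_iff _ _ _).mp hsign
  rw [rSign, neg_one_pow_eq_pow_mod_two, hmod, ← neg_one_pow_eq_pow_mod_two]
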